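/- arXiv:1203.5622 — 2 statements merged into one kernel-verified Lean document; each statement's English description precedes it below -/
import Mathlib

section
/- Let (A, A₊, u_A) be an abstract state space with dim A = d. The following are equivalent: (a) there exist states ω₁, …, ω_d ∈ Ω_A and effects e₁, …, e_d ∈ E_A with e₁ + ⋯ + e_d = u_A and eᵢ(ω_j) = δ_{ij} for all i, j (i.e. the d states are perfectly distinguishable); (b) Ω_A is a (d−1)-simplex, i.e. there are d affinely independent points ω₁, …, ω_d such that Ω_A is their convex hull and the extreme points of Ω_A are exactly ω₁, …, ω_d. -/
open Set

variable {A : Type*} [NormedAddCommGroup A] [NormedSpace ℝ A] [FiniteDimensional ℝ A]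

/-- The set of normalized states of an abstract state space `(A, Apos, u)`. -/
def states (Apos : Set A) (u : Module.Dual ℝ A) : Set A :=
  {ω | ω ∈ Apos ∧ u ω = 1}

/-- The set of effects of an abstract state space `(A, Apos, u)`. -/
def effects (Apos : Set A) (u : Module.Dual ℝ A) : Set (Module.Dual ℝ A) :=
  {f | ∀ ω ∈ states Apos u, 0 ≤ f ω ∧ f ω ≤ 1}

theorem convex_states {Apos : Set A} (u : Module.Dual ℝ A)
    (hadd : ∀ x ∈ Apos, ∀ y ∈ Apos, x + y ∈ Apos)
    (hsmul : ∀ x ∈ Apos, ∀ c : ℝ, 0 ≤ c → c • x ∈ Apos) : Convex ℝ (states Apos u) := by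
  rintro x ⟨hx, hux⟩ y ⟨hy, huy⟩ a b ha hb hab
  exact ⟨hadd _ (hsmul x hx a ha) _ (hsmul y hy b hb), by simp [hux, huy, hab]⟩

section Dual

variable {ι V : Type*} [AddCommGroup V] [Module ℝ V]

/-- An affinely independent family in an affine hyperplane off the origin is linearly
independent. -/
theorem AffineIndependent.linearIndependent_of_dual_eq_one {v : ι → V}
    (hv : AffineIndependent ℝ v) (u : Module.Dual ℝ V) (hu : ∀ i, u (v i) = 1) :
    LinearIndependent ℝ v := by
  rw [linearIndependent_iff']
  intro s w hw
  refine affineIndependent_iff.1 hv s w ?_ hw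
  simpa [hu] using congrArg u hw

variable [Fintype ι]

theorem Module.Basis.sum_coord_eq_of_apply_eq_one (b : Module.Basis ι ℝ V) {u : Module.Dual ℝ V}
    (hu : ∀ i, u (b i) = 1) : ∑ i, b.coord i = u := by
  classical
  exact b.ext fun j => by simp [hu, Finsupp.single_apply]

theorem Module.Basis.convexHull_range_eq (b : Module.Basis ι ℝ V) :
    convexHull ℝ (Set.range b) = {x | (∀ i, 0 ≤ b.coord i x) ∧ ∑ i, b.coord i x = 1} := by
  classical
  refine Set.Subset.antisymm (convexHull_min ?_ ?_) ?_
  · rintro _ ⟨j, rfl⟩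
    refine ⟨fun i => ?_, ?_⟩
    · simp only [Module.Basis.coord_apply, Module.Basis.repr_self, Finsupp.single_apply]
      split_ifs <;> norm_num
    · simp [Finsupp.single_apply]
  · rintro x ⟨hx, hx1⟩ y ⟨hy, hy1⟩ r s hr hs hrs
    refine ⟨fun i => ?_, ?_⟩
    · rw [map_add, map_smul, map_smul]
      exact add_nonneg (mul_nonneg hr (hx i)) (mul_nonneg hs (hy i))
    · simp only [map_add, map_smul, Finset.sum_add_distrib, ← Finset.smul_sum, hx1, hy1]
      simpa using hrs
  · rintro x ⟨hx, hx1⟩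
    exact mem_convexHull_of_exists_fintype (fun i => b.coord i x) b hx hx1
      (fun i => Set.mem_range_self i) (b.sum_repr x)

theorem Module.Basis.extremePoints_convexHull_range (b : Module.Basis ι ℝ V) :
    Set.extremePoints ℝ (convexHull ℝ (Set.range b)) = Set.range b := by
  classical
  refine Set.Subset.antisymm extremePoints_convexHull_subset ?_
  rintro _ ⟨i, rfl⟩
  rw [mem_extremePoints_iff_left]
  refine ⟨subset_convexHull ℝ _ (Set.mem_range_self i), ?_⟩
  rintro x hx y hy ⟨r, s, hr, hs, -, hxy⟩
  rw [b.convexHull_range_eq] at hx hy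
  have hzero : ∀ j, j ≠ i → b.coord j x = 0 := by
    intro j hj
    have h := congrArg (b.coord j) hxy
    rw [map_add, map_smul, map_smul, smul_eq_mul, smul_eq_mul, b.coord_apply j (b i), b.repr_self,
      Finsupp.single_eq_of_ne hj] at h
    have hry := mul_nonneg hs.le (hy.1 j)
    have hrx := mul_nonneg hr.le (hx.1 j)
    exact (mul_eq_zero.1 (by linarith : r * b.coord j x = 0)).resolve_left hr.ne'
  have hone : b.coord i x = 1 := by
    rw [← hx.2, Finset.sum_eq_single i (fun j _ hj => hzero j hj) (by simp)]
  rw [← b.sum_repr x, Finset.sum_eq_single i (fun j _ hj => ?_) (by simp)]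
  · rw [← b.coord_apply, hone, one_smul]
  · rw [← b.coord_apply, hzero j hj, zero_smul]

end Dual

/-- In a `d`-dimensional abstract state space, there exist `d` perfectly
distinguishable states if and only if the set of normalized states is a `(d-1)`-simplex. -/
theorem perfectly_distinguishable_iff_simplex
    (Apos : Set A) (u : Module.Dual ℝ A)
    (hclosed : IsClosed Apos)
    (hadd : ∀ x ∈ Apos, ∀ y ∈ Apos, x + y ∈ Apos)
    (hsmul : ∀ x ∈ Apos, ∀ c : ℝ, 0 ≤ c → c • x ∈ Apos)
    (hpointed : ∀ x ∈ Apos, -x ∈ Apos → x = 0)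
    (hgen : ∀ x : A, ∃ y ∈ Apos, ∃ z ∈ Apos, x = y - z)
    (hu : ∀ x ∈ Apos, x ≠ 0 → 0 < u x) :
    (∃ (ω : Fin (Module.finrank ℝ A) → A) (e : Fin (Module.finrank ℝ A) → Module.Dual ℝ A),
      (∀ i, ω i ∈ states Apos u) ∧ (∀ i, e i ∈ effects Apos u) ∧ (∑ i, e i) = u ∧
      ∀ i j, e i (ω j) = if i = j then 1 else 0) ↔
    (∃ ω : Fin (Module.finrank ℝ A) → A, AffineIndependent ℝ ω ∧
      states Apos u = convexHull ℝ (Set.range ω) ∧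
      Set.extremePoints ℝ (states Apos u) = Set.range ω) := by
  classical
  constructor
  · rintro ⟨ω, e, hω, he, hsum, hdual⟩
    have hli : LinearIndependent ℝ ω := by
      rw [Fintype.linearIndependent_iff]
      intro c hc i
      simpa [hdual] using congrArg (e i) hc
    let b := basisOfLinearIndependentOfCardEqFinrank' ω hli (Fintype.card_fin _)
    have hb : ⇑b = ω := coe_basisOfLinearIndependentOfCardEqFinrank' ω hli _
    have hcoord : ∀ i, b.coord i = e i := fun i => b.ext fun j => by
      rw [b.coord_apply, b.repr_self, hb, hdual, Finsupp.single_apply]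
      simp only [eq_comm]
    have hstates : states Apos u = convexHull ℝ (Set.range ω) := by
      refine Set.Subset.antisymm (fun x hx => ?_)
        (convexHull_min (Set.range_subset_iff.2 hω) (convex_states u hadd hsmul))
      rw [← hb, b.convexHull_range_eq]
      refine ⟨fun i => ?_, ?_⟩
      · rw [hcoord]
        exact (he i x hx).1
      · simp only [hcoord]
        rw [← LinearMap.sum_apply, hsum, hx.2]
    refine ⟨ω, hli.affineIndependent, hstates, ?_⟩
    rw [hstates, ← hb, b.extremePoints_convexHull_range]
  · rintro ⟨ω, hai, hstates, -⟩
    have hω : ∀ i, ω i ∈ states Apos u := fun i =>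
      hstates ▸ subset_convexHull ℝ _ (Set.mem_range_self i)
    have hli := hai.linearIndependent_of_dual_eq_one u fun i => (hω i).2
    let b := basisOfLinearIndependentOfCardEqFinrank' ω hli (Fintype.card_fin _)
    have hb : ⇑b = ω := coe_basisOfLinearIndependentOfCardEqFinrank' ω hli _
    refine ⟨ω, b.coord, hω, fun i x hx => ?_,
      b.sum_coord_eq_of_apply_eq_one fun i => hb ▸ (hω i).2, fun i j => ?_⟩
    · rw [hstates, ← hb, b.convexHull_range_eq] at hx
      exact ⟨hx.1 i, hx.2 ▸ Finset.single_le_sum (fun j _ => hx.1 j) (Finset.mem_univ i)⟩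
    · rw [← hb, b.coord_apply, b.repr_self, Finsupp.single_apply]
      simp only [eq_comm]
end

section
/- Let (A, A₊, u_A) be an abstract state space whose set of normalized states Ω_A is a polytope. If F is a facet of Ω_A, then there exists an extreme point g of E_A such that for every ω ∈ Ω_A one has g(ω) = 1 if and only if ω ∈ F. -/
open Set

variable {A : Type*} [NormedAddCommGroup A] [NormedSpace ℝ A] [FiniteDimensional ℝ A]

/-- `F` is a face of the convex set `C`. -/
def IsFace (C F : Set A) : Prop :=
  F.Nonempty ∧ Convex ℝ F ∧ F ⊆ C ∧
    ∀ x ∈ C, ∀ y ∈ C, ∀ α : ℝ, 0 < α → α < 1 → α • x + (1 - α) • y ∈ F → x ∈ F ∧ y ∈ F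

/-- The dimension of a subset of a vector space: the dimension of its affine hull. -/
noncomputable def setDim (s : Set A) : ℕ := Module.finrank ℝ (affineSpan ℝ s).direction

/-- A face of a convex set contains every point of the set lying in its affine hull. -/
theorem IsFace.mem_of_mem_affineSpan {C F : Set A} (hF : IsFace C F) {z : A} (hz : z ∈ C)
    (hzF : z ∈ affineSpan ℝ F) : z ∈ F := by
  obtain ⟨hne, hconv, hsub, hface⟩ := hF
  obtain ⟨p, hp⟩ := hne.intrinsicInterior hconv
  obtain ⟨y, hy, rfl⟩ := mem_intrinsicInterior.1 hp
  have hyF : (y : A) ∈ F := show _ ∈ Subtype.val ⁻¹' F from interior_subset hy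
  let γ : ℝ → affineSpan ℝ F := fun t => ⟨AffineMap.lineMap z (y : A) t,
    AffineMap.lineMap_mem t hzF y.2⟩
  have hγ : Continuous γ :=
    Continuous.subtype_mk (by fun_prop) _
  have hγ1 : γ 1 = y := Subtype.ext (by simp [γ])
  have hev : ∀ᶠ t in nhds (1 : ℝ), γ t ∈ interior ((↑) ⁻¹' F : Set (affineSpan ℝ F)) := by
    apply hγ.continuousAt.eventually_mem
    rw [hγ1]
    exact isOpen_interior.mem_nhds hy
  obtain ⟨ε, hε, hball⟩ := Metric.eventually_nhds_iff.1 hev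
  have hq : AffineMap.lineMap z (y : A) (1 + ε / 2) ∈ F := by
    have h := hball (y := 1 + ε / 2) (by
      rw [Real.dist_eq, add_sub_cancel_left, abs_of_pos (by positivity)]; linarith)
    exact show _ ∈ Subtype.val ⁻¹' F from interior_subset h
  have hpos : (0 : ℝ) < 1 + ε / 2 := by positivity
  refine (hface _ (hsub hq) z hz (1 + ε / 2)⁻¹ (by positivity)
    (inv_lt_one_of_one_lt₀ (by linarith)) ?_).2
  convert hyF using 1
  rw [AffineMap.lineMap_apply_module]
  match_scalars <;> field_simp
  ring

/-- The direction of the affine hull of the normalized states is the kernel of the unit. -/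
theorem direction_affineSpan_states {Apos : Set A} {u : Module.Dual ℝ A}
    (hsmul : ∀ x ∈ Apos, ∀ c : ℝ, 0 ≤ c → c • x ∈ Apos)
    (hgen : ∀ x : A, ∃ y ∈ Apos, ∃ z ∈ Apos, x = y - z)
    (hu : ∀ x ∈ Apos, x ≠ 0 → 0 < u x) :
    (affineSpan ℝ (states Apos u)).direction = LinearMap.ker u := by
  rw [direction_affineSpan]
  apply le_antisymm
  · rw [vectorSpan_def, Submodule.span_le]
    rintro _ ⟨x, hx, y, hy, rfl⟩
    simp [hx.2, hy.2]
  · intro x hx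
    obtain ⟨y, hy, z, hz, rfl⟩ := hgen x
    have hyz : u y = u z := by simpa [sub_eq_zero] using hx
    by_cases hy0 : y = 0
    · have hz0 : z = 0 := by
        by_contra h
        have := hu z hz h
        simp [← hyz, hy0] at this
      simp [hy0, hz0]
    · have hpos := hu y hy hy0
      have h1 : (u y)⁻¹ • y ∈ states Apos u :=
        ⟨hsmul y hy _ (by positivity), by simp [hpos.ne']⟩
      have h2 : (u y)⁻¹ • z ∈ states Apos u :=
        ⟨hsmul z hz _ (by positivity), by simp [← hyz, hpos.ne']⟩
      have h := (vectorSpan ℝ (states Apos u)).smul_mem (u y) (vsub_mem_vectorSpan ℝ h1 h2)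
      rwa [vsub_eq_sub, ← smul_sub, smul_inv_smul₀ hpos.ne'] at h

/-- A facet of the set of normalized states is cut out by a functional, unique up to scaling. -/
theorem exists_dual_eq_zero_iff_mem_facet {Apos : Set A} {u : Module.Dual ℝ A}
    (hconv : Convex ℝ (states Apos u))
    (hdir : (affineSpan ℝ (states Apos u)).direction = LinearMap.ker u)
    {F : Set A} (hF : IsFace (states Apos u) F)
    (hFdim : setDim F + 1 = setDim (states Apos u)) :
    ∃ h : Module.Dual ℝ A, (∀ ω ∈ states Apos u, 0 ≤ h ω) ∧
      (∀ ω ∈ states Apos u, h ω = 0 ↔ ω ∈ F) ∧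
      ∀ k : Module.Dual ℝ A, (∀ ω ∈ F, k ω = 0) → ∃ c : ℝ, k = c • h := by
  obtain ⟨p, hp⟩ := hF.1
  have hsub := hF.2.2.1
  have hup : u p = 1 := (hsub hp).2
  set D := (affineSpan ℝ F).direction with hD
  have hDle : D ≤ LinearMap.ker u := by
    rw [← hdir]
    exact AffineSubspace.direction_le (affineSpan_mono ℝ hsub)
  have hrank : Module.finrank ℝ D + 1 = Module.finrank ℝ (LinearMap.ker u) := by
    rw [← hdir]; exact hFdim
  obtain ⟨e, he, heD⟩ : ∃ e ∈ LinearMap.ker u, e ∉ D := by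
    by_contra! hcon
    have : D = LinearMap.ker u := le_antisymm hDle hcon
    rw [this] at hrank
    omega
  have hue : u e = 0 := he
  obtain ⟨f, hfe, hfD⟩ := Submodule.exists_le_ker_of_notMem heD
  let h : Module.Dual ℝ A := f - f p • u
  have hhe : h e ≠ 0 := by simpa [h, hue] using hfe
  have hhp : h p = 0 := by simp [h, hup]
  have hker : D = LinearMap.ker h ⊓ LinearMap.ker u := by
    have hle : D ≤ LinearMap.ker h ⊓ LinearMap.ker u := fun x hx => by
      have h1 : f x = 0 := hfD hx
      have h2 : u x = 0 := hDle hx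
      simp [h, h1, h2]
    have hlt : LinearMap.ker h ⊓ LinearMap.ker u < LinearMap.ker u :=
      lt_of_le_of_ne inf_le_right fun heq => hhe (heq.ge he).1
    have := Submodule.finrank_lt_finrank_of_lt hlt
    exact Submodule.eq_of_le_of_finrank_le hle (by omega)
  have hzero : ∀ ω ∈ states Apos u, h ω = 0 ↔ ω ∈ F := by
    refine fun ω hω => ⟨fun h0 => hF.mem_of_mem_affineSpan hω ?_, fun hωF => ?_⟩
    · have hmem : ω -ᵥ p ∈ D := by
        rw [hker]
        simp [h0, hhp, hω.2, hup]
      simpa using AffineSubspace.vadd_mem_of_mem_direction hmem (mem_affineSpan ℝ hp)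
    · have hmem : ω -ᵥ p ∈ D :=
        AffineSubspace.vsub_mem_direction (mem_affineSpan ℝ hωF) (mem_affineSpan ℝ hp)
      rw [hker] at hmem
      simpa [hhp] using hmem.1
  have hprop : ∀ k : Module.Dual ℝ A, (∀ ω ∈ F, k ω = 0) → ∃ c : ℝ, k = c • h := by
    intro k hk
    have hkD : D ≤ LinearMap.ker k := by
      rw [hD, direction_affineSpan, vectorSpan_def, Submodule.span_le]
      rintro _ ⟨x, hx, y, hy, rfl⟩
      simp [hk x hx, hk y hy]
    refine ⟨k e / h e, LinearMap.ext fun x => ?_⟩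
    have hmem : x - u x • p - (h x / h e) • e ∈ D := by
      rw [hker]
      simp [hhp, hup, hue, hhe]
    have := hkD hmem
    simp only [LinearMap.mem_ker, map_sub, map_smul, hk p hp, smul_eq_mul] at this
    simp only [LinearMap.smul_apply, smul_eq_mul]
    linear_combination this
  have hsame : ∀ x ∈ states Apos u, ∀ y ∈ states Apos u, 0 < h x → ¬ h y < 0 := by
    intro x hx y hy hxpos hyneg
    have hd : 0 < h x - h y := by linarith
    have h1 : 0 < -h y / (h x - h y) := div_pos (by linarith) hd
    have h2 : -h y / (h x - h y) < 1 := (div_lt_one hd).2 (by linarith)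
    have hz := hconv hx hy h1.le (sub_pos.2 h2).le (by ring)
    have hzF := (hzero _ hz).1 (by
      simp only [map_add, map_smul, smul_eq_mul]
      field_simp
      ring)
    have := (hzero x hx).2 (hF.2.2.2 x hx y hy _ h1 h2 hzF).1
    linarith
  by_cases hex : ∃ x ∈ states Apos u, 0 < h x
  · obtain ⟨x, hx, hxpos⟩ := hex
    exact ⟨h, fun ω hω => not_lt.1 (hsame x hx ω hω hxpos), hzero, hprop⟩
  · push Not at hex
    refine ⟨-h, fun ω hω => by simpa using hex ω hω, fun ω hω => by simpa using hzero ω hω,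
      fun k hk => ?_⟩
    obtain ⟨c, rfl⟩ := hprop k hk
    exact ⟨-c, by simp⟩

/-- If the set of normalized states of an abstract state space is a polytope
and `F` is a facet of it, then there is a pure effect `g` such that for every normalized state
`ω` one has `g ω = 1` if and only if `ω ∈ F`. -/
theorem facet_has_associated_pure_effect
    (Apos : Set A) (u : Module.Dual ℝ A)
    (hclosed : IsClosed Apos)
    (hadd : ∀ x ∈ Apos, ∀ y ∈ Apos, x + y ∈ Apos)
    (hsmul : ∀ x ∈ Apos, ∀ c : ℝ, 0 ≤ c → c • x ∈ Apos)
    (hpointed : ∀ x ∈ Apos, -x ∈ Apos → x = 0)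
    (hgen : ∀ x : A, ∃ y ∈ Apos, ∃ z ∈ Apos, x = y - z)
    (hu : ∀ x ∈ Apos, x ≠ 0 → 0 < u x)
    (hcpt : IsCompact (states Apos u))
    (hfin : (Set.extremePoints ℝ (states Apos u)).Finite)
    (F : Set A) (hF : IsFace (states Apos u) F)
    (hFdim : setDim F + 1 = setDim (states Apos u)) :
    ∃ g ∈ Set.extremePoints ℝ (effects Apos u),
      ∀ ω ∈ states Apos u, (g ω = 1 ↔ ω ∈ F) := by
  have hconv : Convex ℝ (states Apos u) := by
    intro x hx y hy a b ha hb hab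
    exact ⟨hadd _ (hsmul x hx.1 a ha) _ (hsmul y hy.1 b hb), by simp [hx.2, hy.2, hab]⟩
  obtain ⟨h, hnonneg, hzero, hprop⟩ := exists_dual_eq_zero_iff_mem_facet hconv
    (direction_affineSpan_states hsmul hgen hu) hF hFdim
  have hsub := hF.2.2.1
  obtain ⟨m, hm, hmax⟩ := hcpt.exists_isMaxOn (hF.1.mono hsub)
    (LinearMap.continuous_of_finiteDimensional h).continuousOn
  have hmpos : 0 < h m := by
    refine lt_of_le_of_ne (hnonneg m hm) fun h0 => ?_
    have hFeq : F = states Apos u := hsub.antisymm fun ω hω =>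
      (hzero ω hω).1 (le_antisymm (h0 ▸ hmax hω) (hnonneg ω hω))
    rw [hFeq] at hFdim
    omega
  have hg : ∀ ω ∈ states Apos u, (u - (h m)⁻¹ • h) ω = 1 - h ω / h m := by
    intro ω hω
    simp [hω.2, div_eq_inv_mul]
  have hiff : ∀ ω ∈ states Apos u, (u - (h m)⁻¹ • h) ω = 1 ↔ ω ∈ F := by
    intro ω hω
    rw [hg ω hω, ← hzero ω hω]
    simp [hmpos.ne']
  have hgm : (u - (h m)⁻¹ • h) m = 0 := by rw [hg m hm, div_self hmpos.ne', sub_self]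
  refine ⟨u - (h m)⁻¹ • h, ⟨fun ω hω => ?_, ?_⟩, hiff⟩
  · rw [hg ω hω]
    have h1 : h ω / h m ≤ 1 := (div_le_one hmpos).2 (hmax hω)
    have h2 : 0 ≤ h ω / h m := div_nonneg (hnonneg ω hω) hmpos.le
    constructor <;> linarith
  · rintro a ha b hb ⟨s, t, hs, ht, hst, hab⟩
    have happ : ∀ ω, s * a ω + t * b ω = (u - (h m)⁻¹ • h) ω := fun ω => by
      rw [← hab]; simp
    obtain ⟨c, hc⟩ := hprop (u - a) fun ω hω => by
      have hωs := hsub hω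
      have h1 := happ ω
      rw [(hiff ω hωs).2 hω] at h1
      have h2 := ha ω hωs
      have h3 := hb ω hωs
      rw [LinearMap.sub_apply, hωs.2]
      nlinarith [mul_le_mul_of_nonneg_left h3.2 ht.le]
    have ham : a m = 0 := by
      have h1 := happ m
      rw [hgm] at h1
      have h2 := ha m hm
      have h3 := mul_nonneg ht.le (hb m hm).1
      nlinarith
    have hcm := LinearMap.congr_fun hc m
    rw [LinearMap.sub_apply, hm.2, ham, sub_zero, LinearMap.smul_apply, smul_eq_mul] at hcm
    rw [← eq_inv_of_mul_eq_one_left hcm.symm, ← hc, sub_sub_cancel]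
end
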